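/- Discrete reduced relative entropy rate: with the dG setup, scheme, perturbed scheme and the reduced relative entropy η_R defined below (W ∈ C³(ℝ), γ > 0, μ ≥ 0, a a symmetric bilinear form on V_q), let (u_h, v_h, τ_h) solve the semi-discrete dG scheme on [0,T) and let (ũ_h, ṽ_h, τ̃_h) be a perturbed solution with residuals R_u, R_v, R_τ ∈ C⁰([0,T), V_q). Then for all t ∈ (0,T): d/dt η_R(t) = − (3/4) μ ∫₀¹ (G⁻[v_h − ṽ_h])² dx − ∫₀¹ [ R_v (v_h − ṽ_h) + R_u (τ_h − τ̃_h) + (W′(u_h) − W′(ũ_h)) G⁻[v_h − ṽ_h] ] dx + ∫₀¹ [ (W′(u_h) − W′(ũ_h)) R_u + R_τ G⁻[v_h − ṽ_h] − R_τ R_u ] dx. -/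

import Mathlib

open scoped BigOperators
open MeasureTheory Set

namespace DG

noncomputable def pev (q : ℕ) (c : ℕ → ℕ → ℝ) (n : ℕ) (y : ℝ) : ℝ :=
  ∑ k ∈ Finset.range (q + 1), c n k * y ^ k

noncomputable def pev' (q : ℕ) (c : ℕ → ℕ → ℝ) (n : ℕ) (y : ℝ) : ℝ :=
  ∑ k ∈ Finset.range (q + 1), (k : ℝ) * c n k * y ^ (k - 1)

noncomputable def inner2 (q N : ℕ) (x : ℕ → ℝ) (c d : ℕ → ℕ → ℝ) : ℝ :=
  ∑ n ∈ Finset.range N, ∫ y in (x n)..(x (n + 1)), pev q c n y * pev q d n y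

noncomputable def nsq (q N : ℕ) (x : ℕ → ℝ) (c : ℕ → ℕ → ℝ) : ℝ :=
  inner2 q N x c c

noncomputable def intg (q N : ℕ) (x : ℕ → ℝ) (c : ℕ → ℕ → ℝ) : ℝ :=
  ∑ n ∈ Finset.range N, ∫ y in (x n)..(x (n + 1)), pev q c n y

noncomputable def valR (q : ℕ) (x : ℕ → ℝ) (c : ℕ → ℕ → ℝ) (n : ℕ) : ℝ :=
  pev q c n (x n)

noncomputable def valL (q N : ℕ) (x : ℕ → ℝ) (c : ℕ → ℕ → ℝ) (n : ℕ) : ℝ :=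
  if n = 0 then pev q c (N - 1) (x N) else pev q c (n - 1) (x n)

noncomputable def jmp (q N : ℕ) (x : ℕ → ℝ) (c : ℕ → ℕ → ℝ) (n : ℕ) : ℝ :=
  valL q N x c n - valR q x c n

noncomputable def Bm (q N : ℕ) (x : ℕ → ℝ) (w Ψ : ℕ → ℕ → ℝ) : ℝ :=
  (∑ n ∈ Finset.range N, ∫ y in (x n)..(x (n + 1)), pev' q w n y * pev q Ψ n y)
    - ∑ n ∈ Finset.range N, jmp q N x w n * valL q N x Ψ n

noncomputable def Bp (q N : ℕ) (x : ℕ → ℝ) (w Ψ : ℕ → ℕ → ℝ) : ℝ :=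
  (∑ n ∈ Finset.range N, ∫ y in (x n)..(x (n + 1)), pev' q w n y * pev q Ψ n y)
    - ∑ n ∈ Finset.range N, jmp q N x w n * valR q x Ψ n

def IsGminus (q N : ℕ) (x : ℕ → ℝ) (w g : ℕ → ℕ → ℝ) : Prop :=
  ∀ Ψ : ℕ → ℕ → ℝ, inner2 q N x g Ψ = Bm q N x w Ψ

def IsGplus (q N : ℕ) (x : ℕ → ℝ) (w g : ℕ → ℕ → ℝ) : Prop :=
  ∀ Ψ : ℕ → ℕ → ℝ, inner2 q N x g Ψ = Bp q N x w Ψ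

noncomputable def hseg (x : ℕ → ℝ) (n : ℕ) : ℝ := x (n + 1) - x n

noncomputable def hprev (N : ℕ) (x : ℕ → ℝ) (n : ℕ) : ℝ :=
  if n = 0 then hseg x (N - 1) else hseg x (n - 1)

noncomputable def dGsq (q N : ℕ) (x : ℕ → ℝ) (w : ℕ → ℕ → ℝ) : ℝ :=
  ∑ n ∈ Finset.range N,
    ((∫ y in (x n)..(x (n + 1)), (pev' q w n y) ^ 2)
      + 2 * (jmp q N x w n) ^ 2 / (hprev N x n + hseg x n))

def Partition (N : ℕ) (x : ℕ → ℝ) : Prop :=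
  2 ≤ N ∧ x 0 = 0 ∧ x N = 1 ∧ ∀ n < N, x n < x (n + 1)

def MeshRatio (N : ℕ) (x : ℕ → ℝ) (ρ : ℝ) : Prop :=
  ∀ n < N, hseg x n ≤ ρ * hseg x ((n + 1) % N) ∧ hseg x ((n + 1) % N) ≤ ρ * hseg x n

end DG

namespace DG

/-- The nonlinear term ∫₀¹ W′(u_h) Z dx for a piecewise polynomial u_h. -/
noncomputable def intW' (q N : ℕ) (x : ℕ → ℝ) (W : ℝ → ℝ) (u Z : ℕ → ℕ → ℝ) : ℝ :=
  ∑ n ∈ Finset.range N,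
    ∫ y in (x n)..(x (n + 1)), deriv W (pev q u n y) * pev q Z n y

/-- The perturbed semi-discrete dG scheme on the time set `s` with residuals
Ru, Rv, Rτ: u, v ∈ C¹(s, V_q) (with coefficientwise derivatives u', v'),
τ ∈ C⁰(s, V_q), gv t = G⁻[v t], and for all t ∈ s and all discrete test
functions Φ, Ψ, Z:
∫ ∂ₜu Φ − G⁻[v] Φ = ∫ Ru Φ;
∫ ∂ₜv Ψ − G⁺[τ] Ψ + μ G⁻[v] G⁻[Ψ] = ∫ Rv Ψ;
∫ τ Z − W′(u) Z − γ a(u, Z) = ∫ Rτ Z.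
Here ∫₀¹ G⁻[v] Φ dx = Bm v Φ and ∫₀¹ G⁺[τ] Ψ dx = Bp τ Ψ by definition of the
discrete gradients. -/
def SolvesPert (q N : ℕ) (x : ℕ → ℝ) (s : Set ℝ) (γ μ : ℝ) (W : ℝ → ℝ)
    (a : (ℕ → ℕ → ℝ) → (ℕ → ℕ → ℝ) → ℝ)
    (u u' v v' τ gv Ru Rv Rτ : ℝ → ℕ → ℕ → ℝ) : Prop :=
  (∀ t ∈ s, ∀ n k : ℕ, HasDerivWithinAt (fun r => u r n k) (u' t n k) s t) ∧
  (∀ t ∈ s, ∀ n k : ℕ, HasDerivWithinAt (fun r => v r n k) (v' t n k) s t) ∧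
  (∀ n k : ℕ, ContinuousOn (fun t => u' t n k) s) ∧
  (∀ n k : ℕ, ContinuousOn (fun t => v' t n k) s) ∧
  (∀ n k : ℕ, ContinuousOn (fun t => τ t n k) s) ∧
  (∀ n k : ℕ, ContinuousOn (fun t => Ru t n k) s) ∧
  (∀ n k : ℕ, ContinuousOn (fun t => Rv t n k) s) ∧
  (∀ n k : ℕ, ContinuousOn (fun t => Rτ t n k) s) ∧
  (∀ t ∈ s, IsGminus q N x (v t) (gv t)) ∧
  (∀ t ∈ s, ∀ Φ : ℕ → ℕ → ℝ,
    inner2 q N x (u' t) Φ - Bm q N x (v t) Φ = inner2 q N x (Ru t) Φ) ∧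
  (∀ t ∈ s, ∀ Ψ gΨ : ℕ → ℕ → ℝ, IsGminus q N x Ψ gΨ →
    inner2 q N x (v' t) Ψ - Bp q N x (τ t) Ψ + μ * inner2 q N x (gv t) gΨ
      = inner2 q N x (Rv t) Ψ) ∧
  (∀ t ∈ s, ∀ Z : ℕ → ℕ → ℝ,
    inner2 q N x (τ t) Z - intW' q N x W (u t) Z - γ * a (u t) Z
      = inner2 q N x (Rτ t) Z)

/-- The (unperturbed) semi-discrete dG scheme: `SolvesPert` with vanishing
residuals. -/
def Solves (q N : ℕ) (x : ℕ → ℝ) (s : Set ℝ) (γ μ : ℝ) (W : ℝ → ℝ)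
    (a : (ℕ → ℕ → ℝ) → (ℕ → ℕ → ℝ) → ℝ)
    (u u' v v' τ gv : ℝ → ℕ → ℕ → ℝ) : Prop :=
  SolvesPert q N x s γ μ W a u u' v v' τ gv
    (fun _ _ _ => 0) (fun _ _ _ => 0) (fun _ _ _ => 0)

/-- The discrete energy ∫₀¹ W(u_h) + ½ v_h² dx + (γ/2) a(u_h, u_h). -/
noncomputable def energy (q N : ℕ) (x : ℕ → ℝ) (γ : ℝ) (W : ℝ → ℝ)
    (a : (ℕ → ℕ → ℝ) → (ℕ → ℕ → ℝ) → ℝ) (u v : ℕ → ℕ → ℝ) : ℝ :=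
  (∑ n ∈ Finset.range N,
    ∫ y in (x n)..(x (n + 1)), (W (pev q u n y) + (1 / 2) * (pev q v n y) ^ 2))
    + (γ / 2) * a u u

/-- Time-dependent difference of two families of discrete functions. -/
def dsub (f g : ℝ → ℕ → ℕ → ℝ) (t : ℝ) : ℕ → ℕ → ℝ :=
  fun n k => f t n k - g t n k

/-- Symmetric bilinear form on the discrete space. -/
def SymBilin (a : (ℕ → ℕ → ℝ) → (ℕ → ℕ → ℝ) → ℝ) : Prop :=
  (∀ c d : ℕ → ℕ → ℝ, a c d = a d c) ∧
  (∀ c d e : ℕ → ℕ → ℝ, a (fun n k => c n k + d n k) e = a c e + a d e) ∧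
  (∀ (s : ℝ) (c d : ℕ → ℕ → ℝ), a (fun n k => s * c n k) d = s * a c d)

end DG

namespace DG

/-- The term ∫₀¹ (W′(u_h) − W′(ũ_h)) Z dx. -/
noncomputable def intWdiff (q N : ℕ) (x : ℕ → ℝ) (W : ℝ → ℝ)
    (u ut Z : ℕ → ℕ → ℝ) : ℝ :=
  ∑ n ∈ Finset.range N,
    ∫ y in (x n)..(x (n + 1)),
      (deriv W (pev q u n y) - deriv W (pev q ut n y)) * pev q Z n y

/-- The discrete reduced relative entropy
η_R(t) = ½‖v_h−ṽ_h‖² + (γ/2) a(u_h−ũ_h, u_h−ũ_h)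
          + (μ/4)∫₀ᵗ ‖G⁻[v_h−ṽ_h]‖² ds
(using G⁻[v_h−ṽ_h] = G⁻[v_h] − G⁻[ṽ_h]). -/
noncomputable def etaR (q N : ℕ) (x : ℕ → ℝ) (γ μ : ℝ)
    (a : (ℕ → ℕ → ℝ) → (ℕ → ℕ → ℝ) → ℝ)
    (u v gv ut vt gvt : ℝ → ℕ → ℕ → ℝ) (t : ℝ) : ℝ :=
  (1 / 2) * nsq q N x (dsub v vt t)
    + (γ / 2) * a (dsub u ut t) (dsub u ut t)
    + (μ / 4) * ∫ s in (0 : ℝ)..t, nsq q N x (dsub gv gvt s)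

end DG

namespace DG

lemma pev_cont (q : ℕ) (c : ℕ → ℕ → ℝ) (n : ℕ) : Continuous (pev q c n) := by
  unfold pev; fun_prop

lemma pev'_cont (q : ℕ) (c : ℕ → ℕ → ℝ) (n : ℕ) : Continuous (pev' q c n) := by
  unfold pev'; fun_prop

lemma pev_sub (q : ℕ) (c d : ℕ → ℕ → ℝ) (n : ℕ) (y : ℝ) :
    pev q (fun n k => c n k - d n k) n y = pev q c n y - pev q d n y := by
  simp [pev, sub_mul, Finset.sum_sub_distrib]

lemma pev_add (q : ℕ) (c d : ℕ → ℕ → ℝ) (n : ℕ) (y : ℝ) :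
    pev q (fun n k => c n k + d n k) n y = pev q c n y + pev q d n y := by
  simp [pev, add_mul, Finset.sum_add_distrib]

lemma pev'_sub (q : ℕ) (c d : ℕ → ℕ → ℝ) (n : ℕ) (y : ℝ) :
    pev' q (fun n k => c n k - d n k) n y = pev' q c n y - pev' q d n y := by
  simp [pev', sub_mul, mul_sub, Finset.sum_sub_distrib]

lemma pev_hasDeriv (q : ℕ) (c : ℕ → ℕ → ℝ) (n : ℕ) (y : ℝ) :
    HasDerivAt (pev q c n) (pev' q c n y) y := by
  unfold pev pev'
  have : ∀ k ∈ Finset.range (q+1),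
      HasDerivAt (fun y : ℝ => c n k * y ^ k) ((k : ℝ) * c n k * y ^ (k - 1)) y := by
    intro k _
    have h := (hasDerivAt_pow k y).const_mul (c n k)
    exact h.congr_deriv (by ring)
  exact HasDerivAt.fun_sum this

lemma ii {f : ℝ → ℝ} (hf : Continuous f) (a b : ℝ) : IntervalIntegrable f volume a b :=
  hf.intervalIntegrable a b

lemma inner2_comm (q N : ℕ) (x : ℕ → ℝ) (c d : ℕ → ℕ → ℝ) :
    inner2 q N x c d = inner2 q N x d c := by
  simp only [inner2, mul_comm]

lemma inner2_sub_right (q N : ℕ) (x : ℕ → ℝ) (c d e : ℕ → ℕ → ℝ) :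
    inner2 q N x c (fun n k => d n k - e n k) = inner2 q N x c d - inner2 q N x c e := by
  simp only [inner2, pev_sub, mul_sub]
  rw [← Finset.sum_sub_distrib]
  refine Finset.sum_congr rfl fun n _ => ?_
  exact intervalIntegral.integral_sub (ii ((pev_cont _ _ _).mul (pev_cont _ _ _)) _ _)
    (ii ((pev_cont _ _ _).mul (pev_cont _ _ _)) _ _)

lemma inner2_sub_left (q N : ℕ) (x : ℕ → ℝ) (c d e : ℕ → ℕ → ℝ) :
    inner2 q N x (fun n k => d n k - e n k) c = inner2 q N x d c - inner2 q N x e c := by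
  rw [inner2_comm, inner2_sub_right, inner2_comm, inner2_comm q N x c e]

lemma inner2_zero_left (q N : ℕ) (x : ℕ → ℝ) (c : ℕ → ℕ → ℝ) :
    inner2 q N x (fun _ _ => 0) c = 0 := by
  simp [inner2, pev]

lemma jmp_sub (q N : ℕ) (x : ℕ → ℝ) (c d : ℕ → ℕ → ℝ) (n : ℕ) :
    jmp q N x (fun n k => c n k - d n k) n = jmp q N x c n - jmp q N x d n := by
  unfold jmp valL valR
  split_ifs <;> simp only [pev_sub] <;> ring

lemma Bm_sub (q N : ℕ) (x : ℕ → ℝ) (c d e : ℕ → ℕ → ℝ) :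
    Bm q N x (fun n k => c n k - d n k) e = Bm q N x c e - Bm q N x d e := by
  have h : ∀ n, ∫ y in (x n)..(x (n + 1)), pev' q (fun n k => c n k - d n k) n y * pev q e n y
      = (∫ y in (x n)..(x (n + 1)), pev' q c n y * pev q e n y)
       - ∫ y in (x n)..(x (n + 1)), pev' q d n y * pev q e n y := by
    intro n
    simp only [pev'_sub, sub_mul]
    exact intervalIntegral.integral_sub (ii ((pev'_cont _ _ _).mul (pev_cont _ _ _)) _ _)
      (ii ((pev'_cont _ _ _).mul (pev_cont _ _ _)) _ _)
  simp only [Bm, h, jmp_sub, sub_mul, Finset.sum_sub_distrib]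
  ring

lemma Bp_sub (q N : ℕ) (x : ℕ → ℝ) (c d e : ℕ → ℕ → ℝ) :
    Bp q N x (fun n k => c n k - d n k) e = Bp q N x c e - Bp q N x d e := by
  have h : ∀ n, ∫ y in (x n)..(x (n + 1)), pev' q (fun n k => c n k - d n k) n y * pev q e n y
      = (∫ y in (x n)..(x (n + 1)), pev' q c n y * pev q e n y)
       - ∫ y in (x n)..(x (n + 1)), pev' q d n y * pev q e n y := by
    intro n
    simp only [pev'_sub, sub_mul]
    exact intervalIntegral.integral_sub (ii ((pev'_cont _ _ _).mul (pev_cont _ _ _)) _ _)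
      (ii ((pev'_cont _ _ _).mul (pev_cont _ _ _)) _ _)
  simp only [Bp, h, jmp_sub, sub_mul, Finset.sum_sub_distrib]
  ring

lemma Bdual (q N : ℕ) (hN : 2 ≤ N) (x : ℕ → ℝ) (c d : ℕ → ℕ → ℝ) :
    Bp q N x c d = - Bm q N x d c := by
  have h : ∀ n, (∫ y in (x n)..(x (n + 1)), pev' q c n y * pev q d n y)
      + (∫ y in (x n)..(x (n + 1)), pev' q d n y * pev q c n y)
      = pev q c n (x (n+1)) * pev q d n (x (n+1)) - pev q c n (x n) * pev q d n (x n) := by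
    intro n
    have hc := pev_cont q c n
    have hd := pev_cont q d n
    have hc' := pev'_cont q c n
    have hd' := pev'_cont q d n
    rw [← intervalIntegral.integral_add (ii (by fun_prop) _ _) (ii (by fun_prop) _ _)]
    have := intervalIntegral.integral_eq_sub_of_hasDerivAt
      (f := fun y => pev q c n y * pev q d n y)
      (f' := fun y => pev' q c n y * pev q d n y + pev' q d n y * pev q c n y)
      (a := x n) (b := x (n+1))
      (fun y _ => by
        have := (pev_hasDeriv q c n y).mul (pev_hasDeriv q d n y)
        exact this.congr_deriv (by ring))
      (ii (((pev'_cont _ _ _).mul (pev_cont _ _ _)).add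
        ((pev'_cont _ _ _).mul (pev_cont _ _ _))) _ _)
    exact this
  have hs : ∑ n ∈ Finset.range N, valL q N x c n * valL q N x d n
      = ∑ n ∈ Finset.range N, pev q c n (x (n+1)) * pev q d n (x (n+1)) := by
    obtain ⟨M, rfl⟩ : ∃ M, N = M + 1 := ⟨N - 1, by omega⟩
    rw [Finset.sum_range_succ', Finset.sum_range_succ]
    simp [valL]
  have h1 : ∑ n ∈ Finset.range N, ((∫ y in (x n)..(x (n + 1)), pev' q c n y * pev q d n y)
      + (∫ y in (x n)..(x (n + 1)), pev' q d n y * pev q c n y))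
      = ∑ n ∈ Finset.range N, valL q N x c n * valL q N x d n
        - ∑ n ∈ Finset.range N, valR q x c n * valR q x d n := by
    rw [hs, ← Finset.sum_sub_distrib]
    exact Finset.sum_congr rfl fun n _ => h n
  have h2 : ∑ n ∈ Finset.range N, jmp q N x c n * valR q x d n
      + ∑ n ∈ Finset.range N, jmp q N x d n * valL q N x c n
      = ∑ n ∈ Finset.range N, valL q N x c n * valL q N x d n
        - ∑ n ∈ Finset.range N, valR q x c n * valR q x d n := by
    rw [← Finset.sum_sub_distrib, ← Finset.sum_add_distrib]
    refine Finset.sum_congr rfl fun n _ => ?_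
    unfold jmp; ring
  rw [Finset.sum_add_distrib] at h1
  unfold Bp Bm
  linarith

lemma inner2_expand (q N : ℕ) (x : ℕ → ℝ) (c d : ℕ → ℕ → ℝ) :
    inner2 q N x c d = ∑ n ∈ Finset.range N, ∑ k ∈ Finset.range (q+1),
      ∑ l ∈ Finset.range (q+1), c n k * d n l * ∫ y in (x n)..(x (n+1)), y ^ k * y ^ l := by
  unfold inner2
  refine Finset.sum_congr rfl fun n _ => ?_
  simp only [pev, Finset.sum_mul_sum]
  rw [intervalIntegral.integral_finset_sum
    (fun k _ => ii (by fun_prop) _ _)]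
  refine Finset.sum_congr rfl fun k _ => ?_
  rw [intervalIntegral.integral_finset_sum
    (fun k _ => ii (by fun_prop) _ _)]
  refine Finset.sum_congr rfl fun l _ => ?_
  rw [← intervalIntegral.integral_const_mul]
  congr 1; ext y; ring

/-- vanishing of polynomial from vanishing norm -/
lemma pev_zero_of_nsq (q N : ℕ) (x : ℕ → ℝ) (hx : ∀ n < N, x n < x (n+1)) (c : ℕ → ℕ → ℝ)
    (h : inner2 q N x c c = 0) (n : ℕ) (hn : n < N) (y : ℝ) (hy : y ∈ Set.Icc (x n) (x (n+1))) :
    pev q c n y = 0 := by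
  have hnn : ∀ m ∈ Finset.range N, 0 ≤ ∫ y in (x m)..(x (m + 1)), pev q c m y * pev q c m y := by
    intro m hm
    exact intervalIntegral.integral_nonneg (hx m (Finset.mem_range.1 hm)).le
      (fun y _ => mul_self_nonneg _)
  have h0 := (Finset.sum_eq_zero_iff_of_nonneg hnn).1 h n (Finset.mem_range.2 hn)
  by_contra hne
  have := intervalIntegral.integral_pos (hx n hn)
    (f := fun y => pev q c n y * pev q c n y)
    ((pev_cont _ _ _).mul (pev_cont _ _ _)).continuousOn
    (fun y _ => mul_self_nonneg _) ⟨y, hy, mul_self_pos.2 hne⟩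
  exact this.ne' h0

lemma inner2_congr_right (q N : ℕ) (x : ℕ → ℝ) (hx : ∀ n < N, x n < x (n+1))
    (b c d : ℕ → ℕ → ℝ)
    (h : ∀ n < N, ∀ y ∈ Set.Icc (x n) (x (n+1)), pev q c n y = pev q d n y) :
    inner2 q N x b c = inner2 q N x b d := by
  unfold inner2
  refine Finset.sum_congr rfl fun n hn => ?_
  have hn := Finset.mem_range.1 hn
  refine intervalIntegral.integral_congr fun y hy => ?_
  rw [Set.uIcc_of_le (hx n hn).le] at hy
  simp only [h n hn y hy]

lemma intWdiff_congr (q N : ℕ) (x : ℕ → ℝ) (hx : ∀ n < N, x n < x (n+1)) (W : ℝ → ℝ)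
    (u ut c d : ℕ → ℕ → ℝ)
    (h : ∀ n < N, ∀ y ∈ Set.Icc (x n) (x (n+1)), pev q c n y = pev q d n y) :
    intWdiff q N x W u ut c = intWdiff q N x W u ut d := by
  unfold intWdiff
  refine Finset.sum_congr rfl fun n hn => ?_
  have hn := Finset.mem_range.1 hn
  refine intervalIntegral.integral_congr fun y hy => ?_
  rw [Set.uIcc_of_le (hx n hn).le] at hy
  simp only [h n hn y hy]

lemma intWdiff_sub (q N : ℕ) (x : ℕ → ℝ) (W : ℝ → ℝ) (hW : Continuous (deriv W))
    (u ut c d : ℕ → ℕ → ℝ) :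
    intWdiff q N x W u ut (fun n k => c n k - d n k)
      = intWdiff q N x W u ut c - intWdiff q N x W u ut d := by
  unfold intWdiff
  rw [← Finset.sum_sub_distrib]
  refine Finset.sum_congr rfl fun n _ => ?_
  have hc := pev_cont q c n
  have hd := pev_cont q d n
  have hu := pev_cont q u n
  have hut := pev_cont q ut n
  rw [← intervalIntegral.integral_sub (ii (by fun_prop) _ _) (ii (by fun_prop) _ _)]
  congr 1; ext y; rw [pev_sub]; ring

lemma intWdiff_eq (q N : ℕ) (x : ℕ → ℝ) (W : ℝ → ℝ) (hW : Continuous (deriv W))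
    (u ut c : ℕ → ℕ → ℝ) :
    intWdiff q N x W u ut c = intW' q N x W u c - intW' q N x W ut c := by
  unfold intWdiff intW'
  rw [← Finset.sum_sub_distrib]
  refine Finset.sum_congr rfl fun n _ => ?_
  have hc := pev_cont q c n
  have hu := pev_cont q u n
  have hut := pev_cont q ut n
  rw [← intervalIntegral.integral_sub (ii (by fun_prop) _ _) (ii (by fun_prop) _ _)]
  congr 1; ext y; ring

noncomputable def fcoef (q : ℕ) (x : ℕ → ℝ) (W : ℝ → ℝ) (u ut r : ℕ → ℕ → ℝ) (n k : ℕ) : ℝ :=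
  ∫ y in (x n)..(x (n+1)),
    (pev q r n y - (deriv W (pev q u n y) - deriv W (pev q ut n y))) * y ^ k

lemma fcoef_expand (q N : ℕ) (x : ℕ → ℝ) (W : ℝ → ℝ) (hW : Continuous (deriv W))
    (u ut r Z : ℕ → ℕ → ℝ) :
    inner2 q N x r Z - intWdiff q N x W u ut Z
      = ∑ n ∈ Finset.range N, ∑ k ∈ Finset.range (q+1), fcoef q x W u ut r n k * Z n k := by
  unfold inner2 intWdiff fcoef
  rw [← Finset.sum_sub_distrib]
  refine Finset.sum_congr rfl fun n _ => ?_
  have hc := pev_cont q Z n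
  have hr := pev_cont q r n
  have hu := pev_cont q u n
  have hut := pev_cont q ut n
  rw [← intervalIntegral.integral_sub (ii (by fun_prop) _ _) (ii (by fun_prop) _ _)]
  simp only [← intervalIntegral.integral_mul_const]
  rw [← intervalIntegral.integral_finset_sum (fun k _ => ii (by fun_prop) _ _)]
  congr 1; ext y
  rw [← sub_mul]
  conv_lhs => rw [pev.eq_1 q Z]
  rw [Finset.mul_sum]
  refine Finset.sum_congr rfl fun k _ => ?_
  ring

lemma fcoef_cont (q : ℕ) (x : ℕ → ℝ) (W : ℝ → ℝ) (hW : Continuous (deriv W))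
    (S : Set ℝ) (u ut r : ℝ → ℕ → ℕ → ℝ)
    (hu : ∀ n k, ContinuousOn (fun t => u t n k) S)
    (hut : ∀ n k, ContinuousOn (fun t => ut t n k) S)
    (hr : ∀ n k, ContinuousOn (fun t => r t n k) S) (n k : ℕ) :
    ContinuousOn (fun t => fcoef q x W (u t) (ut t) (r t) n k) S := by
  rw [continuousOn_iff_continuous_restrict]
  simp only [continuousOn_iff_continuous_restrict] at hu hut hr
  have key : ∀ f : ℝ → ℕ → ℕ → ℝ, (∀ n k, Continuous (S.restrict fun t => f t n k)) →
      Continuous (fun p : S × ℝ => pev q (f p.1) n p.2) := by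
    intro f hf
    unfold pev
    refine continuous_finset_sum _ fun k _ => ?_
    exact ((hf n k).comp continuous_fst).mul (continuous_snd.pow k)
  have h1 := key u hu
  have h2 := key ut hut
  have h3 := key r hr
  refine intervalIntegral.continuous_parametric_intervalIntegral_of_continuous'
    (f := fun (t : S) y => (pev q (r t) n y - (deriv W (pev q (u t) n y)
      - deriv W (pev q (ut t) n y))) * y ^ k) ?_ _ _
  unfold Function.uncurry
  exact (h3.sub ((hW.comp h1).sub (hW.comp h2))).mul (continuous_snd.pow k)

lemma hasDerivAt_mul_cont {φ ψ : ℝ → ℝ} {t d : ℝ} (hφ : ContinuousAt φ t)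
    (hψ : HasDerivAt ψ d t) : HasDerivAt (fun s => φ s * (ψ s - ψ t)) (φ t * d) t := by
  rw [hasDerivAt_iff_tendsto_slope] at hψ ⊢
  have h := (hφ.tendsto.mono_left (nhdsWithin_le_nhds (s := {t}ᶜ))).mul hψ
  refine h.congr fun s => ?_
  simp only [slope_def_field]
  ring

end DG

open DG in
theorem stmt_15 (q N : ℕ) (hq : 1 ≤ q) (x : ℕ → ℝ) (hpart : DG.Partition N x)
    (T γ μ : ℝ) (hT : 0 < T) (hγ : 0 < γ) (hμ : 0 ≤ μ)
    (W : ℝ → ℝ) (hW : ContDiff ℝ 3 W)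
    (a : (ℕ → ℕ → ℝ) → (ℕ → ℕ → ℝ) → ℝ) (ha : DG.SymBilin a)
    (u u' v v' τ gv : ℝ → ℕ → ℕ → ℝ)
    (hsol : DG.Solves q N x (Set.Ico 0 T) γ μ W a u u' v v' τ gv)
    (ut ut' vt vt' τt gvt Ru Rv Rτ : ℝ → ℕ → ℕ → ℝ)
    (hpert : DG.SolvesPert q N x (Set.Ico 0 T) γ μ W a ut ut' vt vt' τt gvt Ru Rv Rτ) :
    ∀ t ∈ Set.Ioo (0 : ℝ) T,
      HasDerivAt (DG.etaR q N x γ μ a u v gv ut vt gvt)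
        (-(3 / 4) * μ * DG.nsq q N x (DG.dsub gv gvt t)
          - (DG.inner2 q N x (Rv t) (DG.dsub v vt t)
              + DG.inner2 q N x (Ru t) (DG.dsub τ τt t)
              + DG.intWdiff q N x W (u t) (ut t) (DG.dsub gv gvt t))
          + (DG.intWdiff q N x W (u t) (ut t) (Ru t)
              + DG.inner2 q N x (Rτ t) (DG.dsub gv gvt t)
              - DG.inner2 q N x (Rτ t) (Ru t))) t := by
  intro t ht
  obtain ⟨hN, -, -, hx⟩ := hpart
  have hW' : Continuous (deriv W) := hW.continuous_deriv (by norm_num)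
  obtain ⟨hu, hv, cu', cv', cτ, -, -, -, hG, e1, e2, e3⟩ := hsol
  obtain ⟨hut, hvt, cut', cvt', cτt, cRu, cRv, cRτ, hGt, f1, f2, f3⟩ := hpert
  obtain ⟨asym, aadd, asmul⟩ := ha
  have asub : ∀ c d e : ℕ → ℕ → ℝ, a (fun n k => c n k - d n k) e = a c e - a d e := by
    intro c d e
    have h1 := aadd (fun n k => c n k - d n k) d e
    simp only [sub_add_cancel] at h1
    linarith [show a (fun n k => c n k) e = a c e from rfl]
  have htS : t ∈ Set.Ico 0 T := ⟨ht.1.le, ht.2⟩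
  have hnhds : Set.Ico 0 T ∈ nhds t := Ico_mem_nhds ht.1 ht.2
  simp only [inner2_zero_left] at e1 e2 e3
  -- difference equations
  have hg : ∀ s ∈ Set.Ico 0 T, IsGminus q N x (dsub v vt s) (dsub gv gvt s) := by
    intro s hs Ψ
    unfold dsub
    rw [inner2_sub_left, Bm_sub, hG s hs Ψ, hGt s hs Ψ]
  -- the identification of the discrete gradient
  let p : ℝ → ℕ → ℕ → ℝ := fun s n k => (u' s n k - ut' s n k) - (0 - Ru s n k)
  have hp : ∀ s ∈ Set.Ico 0 T, ∀ Φ, inner2 q N x (dsub gv gvt s) Φ = inner2 q N x (p s) Φ := by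
    intro s hs Φ
    have a1 := e1 s hs Φ
    have a2 := f1 s hs Φ
    have a3 := hg s hs Φ
    unfold dsub at a3
    rw [Bm_sub] at a3
    have a4 : inner2 q N x (p s) Φ = (inner2 q N x (u' s) Φ - inner2 q N x (ut' s) Φ)
        - (0 - inner2 q N x (Ru s) Φ) := by
      have b1 := inner2_sub_left q N x Φ (fun n k => u' s n k - ut' s n k)
        (fun n k => 0 - Ru s n k)
      have b2 := inner2_sub_left q N x Φ (u' s) (ut' s)
      have b3 := inner2_sub_left q N x Φ (fun _ _ => 0) (Ru s)
      rw [inner2_zero_left] at b3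
      rw [b2, b3] at b1
      exact b1
    unfold dsub
    rw [a3, a4]; linarith
  have hpn : ∀ s ∈ Set.Ico 0 T, nsq q N x (dsub gv gvt s) = inner2 q N x (p s) (p s) := by
    intro s hs
    unfold nsq
    rw [hp s hs, inner2_comm, hp s hs]
  -- continuity of the norm
  have cp : ∀ n k, ContinuousOn (fun s => p s n k) (Set.Ico 0 T) := fun n k =>
    ((cu' n k).sub (cut' n k)).sub (continuousOn_const.sub (cRu n k))
  have cn : ContinuousOn (fun s => nsq q N x (dsub gv gvt s)) (Set.Ico 0 T) := by
    refine ContinuousOn.congr (f := fun s => inner2 q N x (p s) (p s)) ?_ hpn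
    simp only [inner2_expand]
    refine continuousOn_finset_sum _ fun n _ => continuousOn_finset_sum _ fun k _ =>
      continuousOn_finset_sum _ fun l _ => ?_
    exact ((cp n k).mul (cp n l)).mul continuousOn_const
  have D3 : HasDerivAt (fun r => ∫ s in (0 : ℝ)..r, nsq q N x (dsub gv gvt s))
      (nsq q N x (dsub gv gvt t)) t := by
    refine intervalIntegral.integral_hasDerivAt_right ?_ ?_ (cn.continuousAt hnhds)
    · refine (cn.mono ?_).intervalIntegrable
      rw [Set.uIcc_of_le ht.1.le]
      exact fun y hy => ⟨hy.1, hy.2.trans_lt ht.2⟩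
    · exact (cn.mono Set.Ioo_subset_Ico_self).stronglyMeasurableAtFilter isOpen_Ioo t ht
  -- derivative of the kinetic part
  have Dv : ∀ n k, HasDerivAt (fun r => dsub v vt r n k) (dsub v' vt' t n k) t := fun n k =>
    ((hv t htS n k).hasDerivAt hnhds).sub ((hvt t htS n k).hasDerivAt hnhds)
  have Du : ∀ n k, HasDerivAt (fun r => dsub u ut r n k) (dsub u' ut' t n k) t := fun n k =>
    ((hu t htS n k).hasDerivAt hnhds).sub ((hut t htS n k).hasDerivAt hnhds)
  have D1 : HasDerivAt (fun r => nsq q N x (dsub v vt r))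
      (2 * inner2 q N x (dsub v' vt' t) (dsub v vt t)) t := by
    have h2 : 2 * inner2 q N x (dsub v' vt' t) (dsub v vt t)
      = inner2 q N x (dsub v' vt' t) (dsub v vt t)
        + inner2 q N x (dsub v vt t) (dsub v' vt' t) := by
      rw [inner2_comm q N x (dsub v vt t)]; ring
    rw [h2]
    unfold nsq
    simp only [inner2_expand, ← Finset.sum_add_distrib, ← add_mul]
    refine HasDerivAt.fun_sum fun n _ => HasDerivAt.fun_sum fun k _ =>
      HasDerivAt.fun_sum fun l _ => ?_
    exact ((Dv n k).mul (Dv n l)).mul_const _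
  -- the bilinear part
  let r : ℝ → ℕ → ℕ → ℝ := fun s n k => dsub τ τt s n k - (0 - Rτ s n k)
  have hr : ∀ s Z, inner2 q N x (r s) Z
      = inner2 q N x (dsub τ τt s) Z + inner2 q N x (Rτ s) Z := by
    intro s Z
    have b1 := inner2_sub_left q N x Z (dsub τ τt s) (fun n k => 0 - Rτ s n k)
    have b3 := inner2_sub_left q N x Z (fun _ _ => 0) (Rτ s)
    rw [inner2_zero_left] at b3
    rw [b3] at b1
    change inner2 q N x (fun n k => dsub τ τt s n k - (0 - Rτ s n k)) Z = _
    rw [b1]; ring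
  have hA : ∀ s ∈ Set.Ico 0 T, ∀ Z, γ * a (dsub u ut s) Z
      = inner2 q N x (r s) Z - intWdiff q N x W (u s) (ut s) Z := by
    intro s hs Z
    have a1 := e3 s hs Z
    have a2 := f3 s hs Z
    rw [hr, intWdiff_eq _ _ _ _ hW']
    unfold dsub
    rw [asub, inner2_sub_left]
    linarith
  let f : ℕ → ℕ → ℝ → ℝ := fun n k s => fcoef q x W (u s) (ut s) (r s) n k
  have hf : ∀ s ∈ Set.Ico 0 T, ∀ Z, γ * a (dsub u ut s) Z
      = ∑ n ∈ Finset.range N, ∑ k ∈ Finset.range (q+1), f n k s * Z n k := by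
    intro s hs Z
    rw [hA s hs, fcoef_expand _ _ _ _ hW']
  have cf : ∀ n k, ContinuousAt (f n k) t := fun n k =>
    (fcoef_cont q x W hW' (Set.Ico 0 T) u ut r
      (fun n k s hs => (hu s hs n k).continuousWithinAt)
      (fun n k s hs => (hut s hs n k).continuousWithinAt)
      (fun n k => ((cτ n k).sub (cτt n k)).sub (continuousOn_const.sub (cRτ n k)))
      n k).continuousAt hnhds
  have D2 : HasDerivAt (fun s => γ * a (dsub u ut s) (dsub u ut s))
      (2 * (γ * a (dsub u ut t) (dsub u' ut' t))) t := by
    have h1 : HasDerivAt (fun s => γ * a (dsub u ut t) (dsub u ut t)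
        + ∑ n ∈ Finset.range N, ∑ k ∈ Finset.range (q+1),
          (f n k s + f n k t) * (dsub u ut s n k - dsub u ut t n k))
        (∑ n ∈ Finset.range N, ∑ k ∈ Finset.range (q+1),
          (f n k t + f n k t) * dsub u' ut' t n k) t := by
      refine HasDerivAt.const_add _ ?_
      refine HasDerivAt.fun_sum fun n _ => HasDerivAt.fun_sum fun k _ => ?_
      exact hasDerivAt_mul_cont (φ := fun s => f n k s + f n k t)
        ((cf n k).add continuousAt_const) (Du n k)
    have h2 : 2 * (γ * a (dsub u ut t) (dsub u' ut' t)) = ∑ n ∈ Finset.range N,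
        ∑ k ∈ Finset.range (q+1), (f n k t + f n k t) * dsub u' ut' t n k := by
      rw [hf t htS]
      simp only [Finset.mul_sum]
      refine Finset.sum_congr rfl fun n _ => Finset.sum_congr rfl fun k _ => ?_
      ring
    rw [h2]
    refine h1.congr_of_eventuallyEq ?_
    filter_upwards [hnhds] with s hs
    have h3 : ∑ n ∈ Finset.range N, ∑ k ∈ Finset.range (q+1),
          (f n k s + f n k t) * (dsub u ut s n k - dsub u ut t n k)
        = γ * a (dsub u ut s) (dsub u ut s) - γ * a (dsub u ut s) (dsub u ut t)
          + γ * a (dsub u ut t) (dsub u ut s) - γ * a (dsub u ut t) (dsub u ut t) := by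
      simp only [hf t htS, hf s hs, ← Finset.sum_sub_distrib, ← Finset.sum_add_distrib]
      refine Finset.sum_congr rfl fun n _ => Finset.sum_congr rfl fun k _ => ?_
      ring
    rw [h3, asym (dsub u ut s) (dsub u ut t)]
    ring
  -- assemble
  have D : HasDerivAt (etaR q N x γ μ a u v gv ut vt gvt)
      ((1 / 2) * (2 * inner2 q N x (dsub v' vt' t) (dsub v vt t))
        + (1 / 2) * (2 * (γ * a (dsub u ut t) (dsub u' ut' t)))
        + (μ / 4) * nsq q N x (dsub gv gvt t)) t := by
    have h := ((D1.const_mul (1/2)).add (D2.const_mul (1/2))).add (D3.const_mul (μ/4))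
    refine h.congr_of_eventuallyEq (Filter.Eventually.of_forall fun s => ?_)
    simp only [etaR, Pi.add_apply]
    ring
  convert D using 1
  have k1 : inner2 q N x (dsub v' vt' t) (dsub v vt t)
      = - inner2 q N x (dsub gv gvt t) (dsub τ τt t) - μ * nsq q N x (dsub gv gvt t)
        - inner2 q N x (Rv t) (dsub v vt t) := by
    have a1 := e2 t htS (dsub v vt t) (dsub gv gvt t) (hg t htS)
    have a2 := f2 t htS (dsub v vt t) (dsub gv gvt t) (hg t htS)
    have a3 := hg t htS (dsub τ τt t)
    have a4 := Bdual q N hN x (dsub τ τt t) (dsub v vt t)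
    have a5 := inner2_sub_left q N x (dsub v vt t) (v' t) (vt' t)
    have a6 := Bp_sub q N x (τ t) (τt t) (dsub v vt t)
    have a7 := inner2_sub_left q N x (dsub gv gvt t) (gv t) (gvt t)
    change inner2 q N x (dsub v' vt' t) _ = _ at a5
    change Bp q N x (dsub τ τt t) _ = _ at a6
    change inner2 q N x (dsub gv gvt t) _ = _ at a7
    unfold nsq
    rw [a7, a3]
    linear_combination a5 + a1 - a2 - a6 + a4
  -- w' agrees with g - Ru
  have hz : inner2 q N x (fun n k => dsub gv gvt t n k - p t n k)
      (fun n k => dsub gv gvt t n k - p t n k) = 0 := by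
    rw [inner2_sub_left, ← hp t htS]
    exact sub_self _
  have hpe : ∀ n < N, ∀ y ∈ Set.Icc (x n) (x (n+1)), pev q (dsub u' ut' t) n y
      = pev q (fun n k => dsub gv gvt t n k - Ru t n k) n y := by
    intro n hn y hy
    have h0 := pev_zero_of_nsq q N x hx _ hz n hn y hy
    have h1 : (fun n k => dsub gv gvt t n k - p t n k)
        = fun n k => (fun n k => dsub gv gvt t n k - Ru t n k) n k - dsub u' ut' t n k := by
      funext n k
      simp only [p, dsub]; ring
    rw [h1, pev_sub] at h0
    linarith
  have k2 := hA t htS (dsub u' ut' t)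
  rw [inner2_congr_right q N x hx _ _ _ hpe, intWdiff_congr q N x hx _ _ _ _ _ hpe,
    inner2_sub_right, intWdiff_sub _ _ _ _ hW', hr, hr] at k2
  rw [k2, k1, inner2_comm q N x (Ru t), inner2_comm q N x (dsub gv gvt t) (dsub τ τt t)]
  ring
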